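/- Let h ≥ 2 and let t be an integer with t ≥ 1 + (log h)/(log 2). Let (W_i)_{i=0}^{h-1} be a partition of the nonnegative integers into nonempty pairwise disjoint sets such that for each i ∈ [0, h−1] there is an infinite set M_i of positive integers with the property that the interval [M − t + 1, M] is contained in W_i for every M ∈ M_i. Let (g_i)_{i=0}^∞ be a G-adic sequence. Then the set A = ⋃_{i=0}^{h-1} A_G(W_i) is a minimal asymptotic basis of order h. -/

import Mathlib

open Finset

/-- A `𝒢`-adic sequence: strictly increasing, `g 0 = 1`, and `g i ∣ g (i+1)` for all `i`. -/
def GadicSeq (g : ℕ → ℕ) : Prop :=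
  StrictMono g ∧ g 0 = 1 ∧ ∀ i, g i ∣ g (i + 1)

/-- The set `A_𝒢(W)` of positive integers `∑_{j ∈ F} x j * g j` with `F` a nonempty finite
subset of `W` and `x j ∈ [1, d_{j+1} - 1]` where `d_{j+1} = g (j+1) / g j`. -/
def AG (g : ℕ → ℕ) (W : Set ℕ) : Set ℕ :=
  { n | ∃ (F : Finset ℕ) (x : ℕ → ℕ), F.Nonempty ∧ ↑F ⊆ W ∧
        (∀ j ∈ F, 1 ≤ x j ∧ x j ≤ g (j + 1) / g j - 1) ∧
        n = ∑ j ∈ F, x j * g j }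

/-- `n` is a sum of `h` (not necessarily distinct) elements of `A`. -/
def IsSumOf (A : Set ℕ) (h n : ℕ) : Prop :=
  ∃ f : Fin h → ℕ, (∀ i, f i ∈ A) ∧ n = ∑ i, f i

/-- `A` is an asymptotic basis of order `h`. -/
def AsympBasis (h : ℕ) (A : Set ℕ) : Prop :=
  ∃ N, ∀ n ≥ N, IsSumOf A h n

/-- `A` is a minimal asymptotic basis of order `h`. -/
def MinAsympBasis (h : ℕ) (A : Set ℕ) : Prop :=
  AsympBasis h A ∧ ∀ B ⊂ A, ¬ AsympBasis h B

namespace GadicSeq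

variable {g : ℕ → ℕ}

theorem pos (hg : GadicSeq g) (k : ℕ) : 0 < g k := by
  have := hg.1.monotone (Nat.zero_le k)
  have h0 := hg.2.1
  omega

theorem succ_eq (hg : GadicSeq g) (k : ℕ) : g (k + 1) = g k * (g (k + 1) / g k) :=
  (Nat.mul_div_cancel' (hg.2.2 k)).symm

theorem two_le_quot (hg : GadicSeq g) (k : ℕ) : 2 ≤ g (k + 1) / g k := by
  have h1 := hg.succ_eq k
  have h2 : g k < g (k + 1) := hg.1 (Nat.lt_succ_self k)
  by_contra! h3
  have : g k * (g (k + 1) / g k) ≤ g k * 1 := Nat.mul_le_mul_left _ (by omega)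
  omega

theorem dvd (hg : GadicSeq g) {k l : ℕ} (hkl : k ≤ l) : g k ∣ g l := by
  induction l, hkl using Nat.le_induction with
  | base => exact dvd_rfl
  | succ l _ ih => exact ih.trans (hg.2.2 l)

theorem two_pow_mul_le (hg : GadicSeq g) (k s : ℕ) : 2 ^ s * g k ≤ g (k + s) := by
  induction s with
  | zero => simp
  | succ s ih =>
    have h1 := hg.succ_eq (k + s)
    have h2 := Nat.mul_le_mul_left (g (k + s)) (hg.two_le_quot (k + s))
    rw [← add_assoc, pow_succ]
    nlinarith

end GadicSeq

/-- The `k`-th digit of `n` in the number system given by `g`. -/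
def gadicDigit (g : ℕ → ℕ) (n k : ℕ) : ℕ := n / g k % (g (k + 1) / g k)

section Digits

variable {g : ℕ → ℕ}

theorem gadicDigit_lt (hg : GadicSeq g) (n k : ℕ) :
    gadicDigit g n k < g (k + 1) / g k :=
  Nat.mod_lt _ (by have := hg.two_le_quot k; omega)

theorem mod_succ_eq (hg : GadicSeq g) (n k : ℕ) :
    n % g (k + 1) = n % g k + gadicDigit g n k * g k := by
  conv_lhs => rw [hg.succ_eq k, Nat.mod_mul]
  rw [gadicDigit, mul_comm (g k)]

theorem sum_gadicDigit (hg : GadicSeq g) (n L : ℕ) :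
    ∑ k ∈ range L, gadicDigit g n k * g k = n % g L := by
  induction L with
  | zero => simp [hg.2.1, Nat.mod_one]
  | succ L ih => rw [sum_range_succ, ih, mod_succ_eq hg]

theorem sum_digits_lt (hg : GadicSeq g) {c : ℕ → ℕ} (hc : ∀ k, c k < g (k + 1) / g k) (L : ℕ) :
    ∑ k ∈ range L, c k * g k < g L := by
  induction L with
  | zero => simp [hg.2.1]
  | succ L ih =>
    rw [sum_range_succ]
    have h1 := hg.succ_eq L
    have h2 := Nat.mul_le_mul_left (g L) (hc L)
    rw [← h1] at h2
    nlinarith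

theorem sum_digits_mod (hg : GadicSeq g) {c : ℕ → ℕ} (hc : ∀ k, c k < g (k + 1) / g k)
    {M L : ℕ} (hML : M ≤ L) :
    (∑ k ∈ range L, c k * g k) % g M = ∑ k ∈ range M, c k * g k := by
  obtain ⟨q, hq⟩ : g M ∣ ∑ k ∈ Ico M L, c k * g k :=
    dvd_sum fun k hk => (hg.dvd (mem_Ico.1 hk).1).mul_left _
  rw [← sum_range_add_sum_Ico _ hML, hq, Nat.add_mul_mod_self_left]
  exact Nat.mod_eq_of_lt (sum_digits_lt hg hc M)

theorem gadicDigit_sum_digits (hg : GadicSeq g) {c : ℕ → ℕ} (hc : ∀ k, c k < g (k + 1) / g k)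
    {k L : ℕ} (hk : k < L) : gadicDigit g (∑ k ∈ range L, c k * g k) k = c k := by
  have h := mod_succ_eq hg (∑ k ∈ range L, c k * g k) k
  rw [sum_digits_mod hg hc hk, sum_digits_mod hg hc hk.le, sum_range_succ] at h
  exact (Nat.eq_of_mul_eq_mul_right (hg.pos k) (Nat.add_left_cancel h)).symm

theorem mod_eq_of_gadicDigit_eq_zero (hg : GadicSeq g) {n k l : ℕ} (hkl : k ≤ l)
    (hz : ∀ i, k ≤ i → i < l → gadicDigit g n i = 0) : n % g l = n % g k := by
  induction l, hkl using Nat.le_induction with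
  | base => rfl
  | succ l hl ih =>
    rw [mod_succ_eq hg, hz l hl (Nat.lt_succ_self l), ih fun i h1 h2 => hz i h1 (by omega)]
    simp

theorem mem_AG_iff (hg : GadicSeq g) {W : Set ℕ} {n : ℕ} :
    n ∈ AG g W ↔ 0 < n ∧ ∀ k, k ∉ W → gadicDigit g n k = 0 := by
  classical
  constructor
  · rintro ⟨F, x, hF, hFW, hx, rfl⟩
    refine ⟨sum_pos (fun j hj => Nat.mul_pos (hx j hj).1 (hg.pos j)) hF, fun k hk => ?_⟩
    have hkF : k ∉ F := fun h => hk (hFW h)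
    set c : ℕ → ℕ := fun k => if k ∈ F then x k else 0 with hc
    have hcd : ∀ k, c k < g (k + 1) / g k := by
      intro k
      have h2 := hg.two_le_quot k
      by_cases h : k ∈ F
      · have := hx k h
        simp only [hc, h, if_true]
        omega
      · simp only [hc, h, if_false]
        omega
    have hsub : F ⊆ range (F.sup id + k + 1) := fun j hj => by
      have : j ≤ F.sup id := le_sup (f := id) hj
      rw [mem_range]
      omega
    have hsum : ∑ j ∈ F, x j * g j = ∑ j ∈ range (F.sup id + k + 1), c j * g j := by
      rw [← sum_subset hsub (fun j _ hj => by simp [hc, hj])]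
      exact sum_congr rfl fun j hj => by simp [hc, hj]
    rw [hsum, gadicDigit_sum_digits hg hcd (by omega)]
    simp [hc, hkF]
  · rintro ⟨hn, hz⟩
    have hng : n < g n.succ := lt_of_lt_of_le n.lt_succ_self hg.1.le_apply
    have hsum := sum_gadicDigit hg n n.succ
    rw [Nat.mod_eq_of_lt hng] at hsum
    have hsum' : n = ∑ k ∈ (range n.succ).filter (fun k => gadicDigit g n k ≠ 0),
        gadicDigit g n k * g k := by
      rw [sum_filter_of_ne, hsum]
      intro k _ h h0
      exact h (by rw [h0, zero_mul])
    refine ⟨(range n.succ).filter (fun k => gadicDigit g n k ≠ 0), gadicDigit g n, ?_, ?_, ?_,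
      hsum'⟩
    · by_contra h
      rw [not_nonempty_iff_eq_empty] at h
      rw [h, sum_empty] at hsum'
      omega
    · intro k hk
      by_contra h
      exact (mem_filter.1 hk).2 (hz k h)
    · intro k hk
      have h1 := (mem_filter.1 hk).2
      have h2 := gadicDigit_lt hg n k
      omega

end Digits

theorem mul_mem_AG {g : ℕ → ℕ} {W : Set ℕ} {j x : ℕ} (hj : j ∈ W) (h1 : 1 ≤ x)
    (h2 : x ≤ g (j + 1) / g j - 1) : x * g j ∈ AG g W :=
  ⟨{j}, fun _ => x, singleton_nonempty j, by simpa using hj, by simp [h1, h2], by simp⟩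

theorem exists_add_of_mem_iUnion_AG {g : ℕ → ℕ} (hg : GadicSeq g) {ι : Type*} {W : ι → Set ℕ}
    (hW : ⋃ i, W i = Set.univ) {n : ℕ} (hn : n ∈ ⋃ i, AG g (W i)) (h1 : 1 < n) :
    ∃ a ∈ ⋃ i, AG g (W i), ∃ b ∈ ⋃ i, AG g (W i), a + b = n := by
  classical
  obtain ⟨i, F, x, hF, hFW, hx, rfl⟩ := Set.mem_iUnion.1 hn
  obtain ⟨j, hj⟩ := hF
  have hxj := hx j hj
  by_cases hE : (F.erase j).Nonempty
  · refine ⟨x j * g j, Set.mem_iUnion.2 ⟨i, mul_mem_AG (hFW hj) hxj.1 hxj.2⟩,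
      ∑ k ∈ F.erase j, x k * g k, Set.mem_iUnion.2 ⟨i, F.erase j, x, hE, ?_, ?_, rfl⟩, ?_⟩
    · exact fun k hk => hFW (mem_of_mem_erase hk)
    · exact fun k hk => hx k (mem_of_mem_erase hk)
    · exact add_sum_erase F (fun k => x k * g k) hj
  · have hFj : F = {j} := by
      rw [not_nonempty_iff_eq_empty, erase_eq_empty_iff] at hE
      rcases hE with rfl | h
      · simp at hj
      · exact h
    subst hFj
    rw [sum_singleton] at h1 ⊢
    by_cases hx2 : 2 ≤ x j
    · refine ⟨(x j - 1) * g j, Set.mem_iUnion.2 ⟨i, mul_mem_AG (hFW hj) (by omega) (by omega)⟩,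
        1 * g j, Set.mem_iUnion.2 ⟨i, mul_mem_AG (hFW hj) le_rfl (by omega)⟩, ?_⟩
      rw [← add_mul, Nat.sub_add_cancel hxj.1]
    · have hx1 : x j = 1 := by omega
      rw [hx1, one_mul] at h1 ⊢
      obtain _ | k := j
      · rw [hg.2.1] at h1
        omega
      · obtain ⟨i', hi'⟩ := Set.mem_iUnion.1 (hW ▸ Set.mem_univ k : k ∈ ⋃ i, W i)
        have h2 := hg.two_le_quot k
        refine ⟨(g (k + 1) / g k - 1) * g k,
          Set.mem_iUnion.2 ⟨i', mul_mem_AG hi' (by omega) le_rfl⟩,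
          1 * g k, Set.mem_iUnion.2 ⟨i', mul_mem_AG hi' le_rfl (by omega)⟩, ?_⟩
        rw [← add_mul, Nat.sub_add_cancel (by omega), mul_comm, ← hg.succ_eq k]

theorem isSumOf_of_multiset {A : Set ℕ} (s : Multiset ℕ) (hs : ∀ a ∈ s, a ∈ A) :
    IsSumOf A s.card s.sum := by
  induction s using Quotient.inductionOn with
  | h l =>
    refine ⟨fun i => l.get i, fun i => hs _ (List.get_mem l i), ?_⟩
    exact (Fin.sum_univ_getElem l).symm

/-- If every element of `A` above `1` splits in `A`, a sum of elements of `A` can be lengthened. -/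
theorem isSumOf_of_multiset_of_splitting {A : Set ℕ}
    (hA : ∀ n ∈ A, 1 < n → ∃ a ∈ A, ∃ b ∈ A, a + b = n) {h : ℕ} (s : Multiset ℕ)
    (hs : ∀ a ∈ s, a ∈ A) (hcard : s.card ≤ h) (hsum : h ≤ s.sum) :
    IsSumOf A h s.sum := by
  obtain ⟨m, hm⟩ := Nat.exists_eq_add_of_le hcard
  induction m generalizing s with
  | zero =>
    have := isSumOf_of_multiset s hs
    rwa [← (show h = s.card by omega)] at this
  | succ m ih =>
    obtain ⟨n, hn, hn1⟩ : ∃ n ∈ s, 1 < n := by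
      by_contra! hcon
      have := Multiset.sum_le_card_nsmul s 1 hcon
      simp at this
      omega
    obtain ⟨a, ha, b, hb, rfl⟩ := hA n (hs n hn) hn1
    obtain ⟨r, rfl⟩ := Multiset.exists_cons_of_mem hn
    have hr : (a ::ₘ b ::ₘ r).sum = ((a + b) ::ₘ r).sum := by simp [add_assoc]
    rw [← hr] at hsum ⊢
    refine ih (a ::ₘ b ::ₘ r) ?_ ?_ hsum ?_
    · intro c hc
      rcases Multiset.mem_cons.1 hc with rfl | hc
      · exact ha
      rcases Multiset.mem_cons.1 hc with rfl | hc
      · exact hb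
      exact hs c (Multiset.mem_cons_of_mem hc)
    · simp at hm ⊢
      omega
    · simp at hm ⊢
      omega

theorem asympBasis_iUnion_AG {g : ℕ → ℕ} (hg : GadicSeq g) {h : ℕ} {W : Fin h → Set ℕ}
    (hd : ∀ i j, i ≠ j → Disjoint (W i) (W j)) (hW : ⋃ i, W i = Set.univ) :
    AsympBasis h (⋃ i, AG g (W i)) := by
  classical
  refine ⟨h, fun n hn => ?_⟩
  have hex : ∀ k, ∃ i, k ∈ W i := fun k => Set.mem_iUnion.1 (hW ▸ Set.mem_univ k)
  have hng : n < g n.succ := lt_of_lt_of_le n.lt_succ_self hg.1.le_apply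
  set p : Fin h → ℕ := fun i => ∑ k ∈ range n.succ,
    (if k ∈ W i then gadicDigit g n k else 0) * g k with hp
  have hlt : ∀ i k, (if k ∈ W i then gadicDigit g n k else 0) < g (k + 1) / g k := by
    intro i k
    split_ifs
    · exact gadicDigit_lt hg n k
    · have := hg.two_le_quot k
      omega
  have hpsum : ∑ i, p i = n := by
    rw [hp, sum_comm]
    conv_rhs => rw [← Nat.mod_eq_of_lt hng, ← sum_gadicDigit hg n n.succ]
    refine sum_congr rfl fun k _ => ?_
    rw [← sum_mul]
    obtain ⟨i, hi⟩ := hex k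
    rw [sum_eq_single i, if_pos hi]
    · intro j _ hj
      rw [if_neg fun hk => Set.disjoint_left.1 (hd j i hj) hk hi]
    · simp
  have hpA : ∀ i, p i ≠ 0 → p i ∈ AG g (W i) := by
    intro i hi
    refine (mem_AG_iff hg).2 ⟨Nat.pos_of_ne_zero hi, fun k hk => ?_⟩
    by_cases hkn : k < n.succ
    · rw [hp, gadicDigit_sum_digits hg (hlt i) hkn, if_neg hk]
    · rw [gadicDigit, Nat.div_eq_of_lt, Nat.zero_mod]
      exact (sum_digits_lt hg (hlt i) n.succ).trans_le (hg.1.monotone (not_lt.1 hkn))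
  have hs : ((univ.filter fun i => p i ≠ 0).val.map p).sum = n := by
    conv_rhs => rw [← hpsum]
    exact sum_filter_ne_zero univ
  rw [← hs]
  apply isSumOf_of_multiset_of_splitting
    (fun m hm h1 => exists_add_of_mem_iUnion_AG hg hW hm h1)
  · intro a ha
    obtain ⟨i, hi, rfl⟩ := Multiset.mem_map.1 ha
    exact Set.mem_iUnion.2 ⟨i, hpA i (mem_filter.1 (mem_def.2 hi)).2⟩
  · rw [Multiset.card_map]
    exact (card_filter_le _ _).trans_eq (by simp)
  · rw [hs]
    exact hn

/-- A number with a nonzero digit at `M` cannot be a sum of `h` numbers whose digits vanish on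
`[M + 1 - t, M]`. -/
theorem exists_gadicDigit_ne_zero_of_sum {g : ℕ → ℕ} (hg : GadicSeq g) {h t M : ℕ}
    (hht : h ≤ 2 ^ (t - 1)) (ht : 1 ≤ t) (htM : t ≤ M) {f : Fin h → ℕ}
    (hM : gadicDigit g (∑ l, f l) M ≠ 0) :
    ∃ l, ∃ k ∈ Set.Icc (M + 1 - t) M, gadicDigit g (f l) k ≠ 0 := by
  by_contra! hcon
  have hmod : ∀ l, f l % g (M + 1) < g (M + 1 - t) := by
    intro l
    rw [mod_eq_of_gadicDigit_eq_zero hg (k := M + 1 - t) (by omega)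
      fun k h1 h2 => hcon l k ⟨h1, by omega⟩]
    exact Nat.mod_lt _ (hg.pos _)
  have hh : Nonempty (Fin h) := by
    by_contra hh
    rw [not_nonempty_iff] at hh
    simp [gadicDigit] at hM
  have hlow : ∑ l, f l % g (M + 1) < g M :=
    calc ∑ l, f l % g (M + 1) < ∑ _l : Fin h, g (M + 1 - t) :=
          sum_lt_sum_of_nonempty univ_nonempty fun l _ => hmod l
      _ = h * g (M + 1 - t) := by simp
      _ ≤ 2 ^ (t - 1) * g (M + 1 - t) := Nat.mul_le_mul_right _ hht
      _ ≤ g (M + 1 - t + (t - 1)) := hg.two_pow_mul_le _ _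
      _ = g M := by congr 1; omega
  have h1 : (∑ l, f l) % g (M + 1) < g M := by
    rw [sum_nat_mod]
    exact (Nat.mod_le _ _).trans_lt hlow
  rw [mod_succ_eq hg] at h1
  have := Nat.mul_le_mul_right (g M) (Nat.one_le_iff_ne_zero.2 hM)
  omega

/-- A self-map of `Fin h` attaining all values but perhaps `i` has a bijective section off `i`. -/
theorem exists_bijective_section {h : ℕ} (i : Fin h) (cl : Fin h → Fin h)
    (hcl : ∀ j, j ≠ i → ∃ l, cl l = j) :
    ∃ σ : Fin h → Fin h, Function.Bijective σ ∧ ∀ j, j ≠ i → cl (σ j) = j := by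
  choose! s hs using hcl
  obtain ⟨l₀, hl₀⟩ : ∃ l₀, l₀ ∉ (univ.erase i).image s := by
    by_contra! hcon
    have h1 := card_le_card (fun l _ => hcon l : univ ⊆ (univ.erase i).image s)
    have h2 := card_image_le (s := univ.erase i) (f := s)
    have h3 := card_erase_lt_of_mem (mem_univ i)
    omega
  have hne : ∀ j, j ≠ i → s j ≠ l₀ := fun j hj h =>
    hl₀ (mem_image.2 ⟨j, mem_erase.2 ⟨hj, mem_univ j⟩, h⟩)
  refine ⟨Function.update s i l₀, Finite.injective_iff_bijective.1 ?_, fun j hj => ?_⟩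
  · intro a b hab
    by_cases ha : a = i <;> by_cases hb : b = i
    · rw [ha, hb]
    · subst ha
      simp [hb] at hab
      exact absurd hab.symm (hne b hb)
    · subst hb
      simp [ha] at hab
      exact absurd hab (hne a ha)
    · simp [ha, hb] at hab
      rw [← hs a ha, ← hs b hb, hab]
  · rw [Function.update_of_ne hj, hs j hj]

/-- If `n` has the digits of `a` on `W i` and the largest possible digits elsewhere, then a sum
representing `n` with one summand for each class other than `i` has `a` as remaining summand. -/
theorem eq_of_sum_eq {g : ℕ → ℕ} (hg : GadicSeq g) {h : ℕ} {W : Fin h → Set ℕ}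
    (hd : ∀ i j, i ≠ j → Disjoint (W i) (W j)) (hW : ⋃ i, W i = Set.univ) {i : Fin h} {a T : ℕ}
    (ha : a ∈ AG g (W i)) (haT : a < g T) {c : ℕ → ℕ}
    (hci : ∀ k ∈ W i, c k = gadicDigit g a k) (hc : ∀ k ∉ W i, c k = g (k + 1) / g k - 1)
    {b : Fin h → ℕ} (hb : ∀ j, j ≠ i → b j ∈ AG g (W j)) (hbi : b i ∈ ⋃ j, AG g (W j))
    (hsum : ∑ k ∈ range T, c k * g k = ∑ j, b j) : b i = a := by
  classical
  have hex : ∀ k, ∃ j, k ∈ W j := fun k => Set.mem_iUnion.1 (hW ▸ Set.mem_univ k)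
  have hcd : ∀ k, c k < g (k + 1) / g k := by
    intro k
    by_cases hk : k ∈ W i
    · rw [hci k hk]
      exact gadicDigit_lt hg a k
    · rw [hc k hk]
      have := hg.two_le_quot k
      omega
  have hbT : ∀ j, b j < g T := fun j =>
    (single_le_sum (f := b) (fun _ _ => Nat.zero_le _) (mem_univ j)).trans_lt
      (hsum ▸ sum_digits_lt hg hcd T)
  set D : ℕ → ℕ := fun k => ∑ j ∈ univ.erase i, gadicDigit g (b j) k with hD
  have hDi : ∀ k ∈ W i, D k = 0 := by
    intro k hk
    refine sum_eq_zero fun j hj => ?_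
    have hj := ne_of_mem_erase hj
    exact ((mem_AG_iff hg).1 (hb j hj)).2 k fun hkj => Set.disjoint_left.1 (hd j i hj) hkj hk
  have hDc : ∀ k, D k ≤ c k := by
    intro k
    by_cases hk : k ∈ W i
    · rw [hDi k hk]
      exact Nat.zero_le _
    · obtain ⟨j, hj⟩ := hex k
      have hji : j ≠ i := fun h => hk (h ▸ hj)
      rw [hc k hk, hD]
      simp only
      rw [sum_eq_single j]
      · have := gadicDigit_lt hg (b j) k
        omega
      · intro l hl hlj
        exact ((mem_AG_iff hg).1 (hb l (ne_of_mem_erase hl))).2 k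
          fun hkl => Set.disjoint_left.1 (hd l j hlj) hkl hj
      · exact fun h => absurd (mem_erase.2 ⟨hji, mem_univ j⟩) h
  have hDsum : ∑ k ∈ range T, D k * g k = ∑ j ∈ univ.erase i, b j := by
    simp only [hD, sum_mul]
    rw [sum_comm]
    refine sum_congr rfl fun j _ => ?_
    rw [sum_gadicDigit hg, Nat.mod_eq_of_lt (hbT j)]
  have hbi_eq : b i = ∑ k ∈ range T, (c k - D k) * g k := by
    have h1 : ∑ k ∈ range T, (c k - D k) * g k + ∑ k ∈ range T, D k * g k =
        ∑ k ∈ range T, c k * g k := by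
      rw [← sum_add_distrib]
      exact sum_congr rfl fun k _ => by rw [← add_mul, Nat.sub_add_cancel (hDc k)]
    have h2 := add_sum_erase univ b (mem_univ i)
    omega
  have hdig : ∀ k < T, gadicDigit g (b i) k = c k - D k := fun k hk => by
    rw [hbi_eq, gadicDigit_sum_digits hg (fun k => (Nat.sub_le _ _).trans_lt (hcd k)) hk]
  have hdigi : ∀ k < T, k ∈ W i → gadicDigit g (b i) k = gadicDigit g a k := fun k hk hki => by
    rw [hdig k hk, hDi k hki, hci k hki, Nat.sub_zero]
  have hapos := ((mem_AG_iff hg).1 ha)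
  have hasum := sum_gadicDigit hg a T
  rw [Nat.mod_eq_of_lt haT] at hasum
  obtain ⟨m, hm⟩ := Set.mem_iUnion.1 hbi
  have hmz := ((mem_AG_iff hg).1 hm).2
  have hmi : m = i := by
    by_contra hmi
    have : a = 0 := by
      rw [← hasum]
      refine sum_eq_zero fun k hk => ?_
      by_cases hki : k ∈ W i
      · rw [← hdigi k (mem_range.1 hk) hki,
          hmz k fun hkm => Set.disjoint_left.1 (hd m i hmi) hkm hki, zero_mul]
      · rw [hapos.2 k hki, zero_mul]
    omega
  subst hmi
  rw [← Nat.mod_eq_of_lt (hbT m), ← sum_gadicDigit hg, ← hasum]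
  refine sum_congr rfl fun k hk => ?_
  by_cases hki : k ∈ W m
  · rw [hdigi k (mem_range.1 hk) hki]
  · rw [hmz k hki, hapos.2 k hki]

theorem le_two_pow_of_log_le {h t : ℕ} (hh : 1 ≤ h)
    (ht : (1 : ℝ) + Real.log h / Real.log 2 ≤ t) : 1 ≤ t ∧ h ≤ 2 ^ (t - 1) := by
  have hl2 : 0 < Real.log 2 := Real.log_pos one_lt_two
  have hlh : 0 ≤ Real.log h := Real.log_nonneg (by exact_mod_cast hh)
  have ht1 : 1 ≤ t := by
    have : (1 : ℝ) ≤ t := by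
      have := div_nonneg hlh hl2.le
      linarith
    exact_mod_cast this
  refine ⟨ht1, ?_⟩
  have h1 : Real.log h ≤ ((t - 1 : ℕ) : ℝ) * Real.log 2 := by
    rw [← div_le_iff₀ hl2, Nat.cast_sub ht1]
    push_cast
    linarith
  rw [← Real.log_pow, Real.log_le_log_iff (by exact_mod_cast hh) (by positivity)] at h1
  exact_mod_cast h1

theorem gadic_minimal_asymptotic_basis (h t : ℕ) (hh : 2 ≤ h)
    (ht : (1 : ℝ) + Real.log h / Real.log 2 ≤ t)
    (W : Fin h → Set ℕ) (hW1 : ∀ i, (W i).Nonempty)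
    (hW2 : ∀ i j, i ≠ j → Disjoint (W i) (W j))
    (hW3 : ⋃ i, W i = Set.univ)
    (hM : ∀ i, ∃ Mi : Set ℕ, Mi.Infinite ∧
      ∀ M ∈ Mi, 0 < M ∧ Set.Icc (M + 1 - t) M ⊆ W i)
    (g : ℕ → ℕ) (hg : GadicSeq g) :
    MinAsympBasis h (⋃ i, AG g (W i)) := by
  classical
  refine ⟨asympBasis_iUnion_AG hg hW2 hW3, ?_⟩
  rintro B hBA ⟨N, hN⟩
  obtain ⟨ht1, hht⟩ := le_two_pow_of_log_le (by omega) ht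
  obtain ⟨a, haA, haB⟩ := Set.exists_of_ssubset hBA
  obtain ⟨i, hai⟩ := Set.mem_iUnion.1 haA
  have hwin : ∀ j, ∃ M, N + t ≤ M ∧ Set.Icc (M + 1 - t) M ⊆ W j := by
    intro j
    obtain ⟨S, hS, hSM⟩ := hM j
    obtain ⟨M, hMS, hlt⟩ := hS.exists_gt (N + t)
    exact ⟨M, hlt.le, (hSM M hMS).2⟩
  choose M hMN hMW using hwin
  obtain ⟨T, haT, hMT⟩ : ∃ T, a < g T ∧ ∀ j, M j < T := by
    refine ⟨a + univ.sup M + 1, ?_, fun j => ?_⟩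
    · exact lt_of_lt_of_le (by omega) (hg.1.le_apply (x := a + univ.sup M + 1))
    · have : M j ≤ univ.sup M := le_sup (mem_univ j)
      omega
  set c : ℕ → ℕ := fun k => if k ∈ W i then gadicDigit g a k else g (k + 1) / g k - 1 with hc
  have hci : ∀ k ∈ W i, c k = gadicDigit g a k := fun k hk => if_pos hk
  have hco : ∀ k ∉ W i, c k = g (k + 1) / g k - 1 := fun k hk => if_neg hk
  have hcd : ∀ k, c k < g (k + 1) / g k := by
    intro k
    by_cases hk : k ∈ W i
    · rw [hci k hk]
      exact gadicDigit_lt hg a k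
    · rw [hco k hk]
      have := hg.two_le_quot k
      omega
  have hMi : ∀ j, j ≠ i → c (M j) ≠ 0 := by
    intro j hj
    have h1 : M j ∈ W j := hMW j ⟨by omega, le_rfl⟩
    rw [hco _ fun h2 => Set.disjoint_left.1 (hW2 j i hj) h1 h2]
    have := hg.two_le_quot (M j)
    omega
  have hn : N ≤ ∑ k ∈ range T, c k * g k := by
    have : Nontrivial (Fin h) := Fin.nontrivial_iff_two_le.2 hh
    obtain ⟨j, hj⟩ := exists_ne i
    calc N ≤ M j := by have := hMN j; omega
      _ ≤ g (M j) := hg.1.le_apply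
      _ ≤ c (M j) * g (M j) := Nat.le_mul_of_pos_left _ (Nat.pos_of_ne_zero (hMi j hj))
      _ ≤ _ := single_le_sum (f := fun k => c k * g k) (fun _ _ => Nat.zero_le _)
          (mem_range.2 (hMT j))
  obtain ⟨f, hfB, hf⟩ := hN _ hn
  have hfA : ∀ l, ∃ m, f l ∈ AG g (W m) := fun l => Set.mem_iUnion.1 (hBA.1 (hfB l))
  choose cl hcl using hfA
  have hcov : ∀ j, j ≠ i → ∃ l, cl l = j := by
    intro j hj
    have hdig : gadicDigit g (∑ l, f l) (M j) ≠ 0 := by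
      rw [← hf, gadicDigit_sum_digits hg hcd (hMT j)]
      exact hMi j hj
    obtain ⟨l, k, hk, hne⟩ := exists_gadicDigit_ne_zero_of_sum hg hht ht1
      (by have := hMN j; omega) hdig
    refine ⟨l, ?_⟩
    by_contra hlj
    exact hne (((mem_AG_iff hg).1 (hcl l)).2 k
      fun hkl => Set.disjoint_left.1 (hW2 _ _ hlj) hkl (hMW j hk))
  obtain ⟨σ, hσ, hσcl⟩ := exists_bijective_section i cl hcov
  have hsum : ∑ k ∈ range T, c k * g k = ∑ j, f (σ j) := by
    rw [hf]
    exact (hσ.sum_comp f).symm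
  have hfa : f (σ i) = a := eq_of_sum_eq (b := fun j => f (σ j)) hg hW2 hW3 hai haT hci hco
    (fun j hj => by simpa only [hσcl j hj] using hcl (σ j)) (hBA.1 (hfB (σ i))) hsum
  exact haB (hfa ▸ hfB (σ i))
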